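/- arXiv:2108.00226 — 8 statements merged into one kernel-verified Lean document; each statement's English description precedes it below -/
import Mathlib

section
/- Fix an integer g ≥ 0. For each n ≥ 1 with 3g−3+n ≥ 0, let C_n be a function from partitions to ℚ that vanishes on every partition λ unless all parts of λ lie in {2,…,n} and |λ| ≤ 3g−3+n, and define A_n := Σ_λ C_n(λ)·e_λ(x_1,…,x_n)·e_1(x_1,…,x_n)^{3g−3+n−|λ|} in ℚ[x_1,…,x_n]. Suppose the string equation holds: for every such n, A_{n+1}(x_1,…,x_n,0) = e_1(x_1,…,x_n)·A_n(x_1,…,x_n). Then the coefficients are independent of n: for every n ≥ 1 with 3g−3+n ≥ 0 and every partition λ with all parts in {2,…,n} and |λ| ≤ 3g−3+n, one has C_{n+1}(λ) = C_n(λ). -/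
open MvPolynomial

/-- `e_λ = ∏_{a ∈ λ} e_a`, the product of elementary symmetric polynomials
indexed by the parts of the partition `p` (a multiset of positive integers). -/
noncomputable def esymmProd (n : ℕ) (p : Multiset ℕ) : MvPolynomial (Fin n) ℚ :=
  (p.map (esymm (Fin n) ℚ)).prod

/-- The amplitude `A_n = Σ_λ C(λ) · e_λ · e_1 ^ (3g-3+n-|λ|)` in `ℚ[x_1,…,x_n]`. -/
noncomputable def amplitude (g n : ℕ) (C : Multiset ℕ → ℚ) : MvPolynomial (Fin n) ℚ :=
  ∑ᶠ p : Multiset ℕ,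
    C p • (esymmProd n p * (esymm (Fin n) ℚ 1) ^ (3 * g + n - 3 - p.sum))

/-- Setting the last variable `x_{n+1}` to zero. -/
noncomputable def setLastZero (n : ℕ) :
    MvPolynomial (Fin (n + 1)) ℚ →ₐ[ℚ] MvPolynomial (Fin n) ℚ :=
  aeval (Fin.lastCases 0 X)

/-- Adjoining a zero to a multiset does not change its elementary symmetric functions. -/
lemma Multiset.esymm_zero_cons {R : Type*} [CommSemiring R] (s : Multiset R) (k : ℕ) :
    (0 ::ₘ s).esymm k = s.esymm k := by
  cases k with
  | zero => simp [Multiset.esymm]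
  | succ k => simp [Multiset.esymm, Multiset.powersetCard_cons]

lemma setLastZero_esymm (n k : ℕ) :
    setLastZero n (esymm (Fin (n + 1)) ℚ k) = esymm (Fin n) ℚ k := by
  have h : (Finset.univ : Finset (Fin (n + 1))).val.map
      (Fin.lastCases (motive := fun _ => MvPolynomial (Fin n) ℚ) 0 X)
      = 0 ::ₘ (Finset.univ : Finset (Fin n)).val.map X := by
    rw [Fin.univ_castSuccEmb, Finset.cons_val, Multiset.map_cons, Fin.lastCases_last,
      Finset.map_val, Multiset.map_map]
    congr 1
    exact Multiset.map_congr rfl fun i _ => by simp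
  rw [setLastZero, aeval_esymm_eq_multiset_esymm, h, Multiset.esymm_zero_cons,
    esymm_eq_multiset_esymm]

lemma setLastZero_esymmProd (n : ℕ) (p : Multiset ℕ) :
    setLastZero n (esymmProd (n + 1) p) = esymmProd n p := by
  simp [esymmProd, map_multiset_prod, Multiset.map_map, setLastZero_esymm]

lemma esymm_fin_eq_zero {n k : ℕ} (h : n < k) : esymm (Fin n) ℚ k = 0 := by
  rw [esymm, Finset.powersetCard_eq_empty.2 (by simpa using h), Finset.sum_empty]

lemma esymmProd_eq_zero {n a : ℕ} {p : Multiset ℕ} (ha : a ∈ p) (h : n < a) :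
    esymmProd n p = 0 :=
  Multiset.prod_eq_zero (Multiset.mem_map.2 ⟨a, ha, esymm_fin_eq_zero h⟩)

/-- The products `e_λ`, over all partitions `λ` with parts in `{1,…,n}`, are linearly independent. -/
lemma linearIndependent_esymmProd (n : ℕ) :
    LinearIndependent ℚ
      fun s : Multiset (Fin n) => esymmProd n (s.map fun i : Fin n => (i : ℕ) + 1) := by
  have hinj : Function.Injective (aeval (R := ℚ) fun i : Fin n => esymm (Fin n) ℚ (i + 1)) := by
    intro p q h
    rw [← esymmAlgHom_apply, ← esymmAlgHom_apply] at h
    exact esymmAlgHom_injective ℚ (by simp) (Subtype.ext h)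
  have hmon : ∀ s : Multiset (Fin n), (s.map (X : Fin n → MvPolynomial (Fin n) ℚ)).prod
      = monomial (Multiset.toFinsupp s) 1 := by
    intro s
    induction s using Multiset.induction_on with
    | empty => simp
    | cons a s ih =>
      rw [Multiset.map_cons, Multiset.prod_cons, ih, ← Multiset.singleton_add,
        map_add, Multiset.toFinsupp_singleton, X, monomial_mul, one_mul]
  have hli := ((basisMonomials (Fin n) ℚ).linearIndependent.comp _
    (Multiset.toFinsupp (α := Fin n)).injective).map_injOn
    (aeval (R := ℚ) fun i : Fin n => esymm (Fin n) ℚ (i + 1)).toLinearMap hinj.injOn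
  have hfun : (fun s : Multiset (Fin n) => esymmProd n (s.map fun i : Fin n => (i : ℕ) + 1))
      = (aeval (R := ℚ) fun i : Fin n => esymm (Fin n) ℚ (i + 1)).toLinearMap ∘
        basisMonomials (Fin n) ℚ ∘ Multiset.toFinsupp := by
    funext s
    simp [← hmon, esymmProd, map_multiset_prod, Multiset.map_map]
  rw [hfun]
  exact hli

/-- The homogeneous products `e_λ e_1 ^ (M - |λ|)`, over the partitions `λ` of size at most `M`
with parts in `{2,…,n}`, are linearly independent. -/
lemma linearIndepOn_esymmProd_mul_pow {n : ℕ} (hn : 1 ≤ n) (M : ℕ) :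
    LinearIndepOn ℚ (fun p => esymmProd n p * esymm (Fin n) ℚ 1 ^ (M - p.sum))
      {p : Multiset ℕ | ∀ a ∈ p, 2 ≤ a ∧ a ≤ n} := by
  have hlift : ∀ p : {p : Multiset ℕ | ∀ a ∈ p, 2 ≤ a ∧ a ≤ n}, ∃ s : Multiset (Fin n),
      s.map (fun i : Fin n => (i : ℕ) + 1) = p.1 + Multiset.replicate (M - p.1.sum) 1 := by
    rintro ⟨p, hp⟩
    have hpos : ∀ a ∈ p + Multiset.replicate (M - p.sum) 1, ∃ i : Fin n, (i : ℕ) + 1 = a := by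
      intro a ha
      have h : 1 ≤ a ∧ a ≤ n := by
        rcases Multiset.mem_add.1 ha with h | h
        · exact ⟨by linarith [(hp a h).1], (hp a h).2⟩
        · rw [Multiset.eq_of_mem_replicate h]
          exact ⟨le_rfl, hn⟩
      exact ⟨⟨a - 1, by omega⟩, by simp; omega⟩
    have : CanLift ℕ (Fin n) (fun i => (i : ℕ) + 1) fun a => ∃ i : Fin n, (i : ℕ) + 1 = a :=
      ⟨fun _ h => h⟩
    exact (Multiset.canLift (fun i : Fin n => (i : ℕ) + 1)
      fun a => ∃ i : Fin n, (i : ℕ) + 1 = a).prf _ hpos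
  choose s hs using hlift
  have hfilter : ∀ p : {p : Multiset ℕ | ∀ a ∈ p, 2 ≤ a ∧ a ≤ n},
      ((s p).map (fun i : Fin n => (i : ℕ) + 1)).filter (· ≠ 1) = p.1 := by
    intro p
    rw [hs, Multiset.filter_add, Multiset.filter_eq_self.2 fun a ha => by
        have := (p.2 a ha).1; omega,
      Multiset.filter_eq_nil.2 fun a ha => by simp [Multiset.eq_of_mem_replicate ha], add_zero]
  have hinj : Function.Injective s := fun p q h => by
    rw [Subtype.ext_iff, ← hfilter p, ← hfilter q, h]
  have hli := (linearIndependent_esymmProd n).comp s hinj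
  rw [LinearIndepOn]
  convert hli using 2 with p
  simp only [Function.comp_apply, hs]
  simp [esymmProd]

/-- The amplitude as a sum over a finite set containing the support of the coefficients. -/
lemma amplitude_eq_sum (g n : ℕ) (C : Multiset ℕ → ℚ) (S : Finset (Multiset ℕ))
    (hS : ∀ p, C p ≠ 0 → p ∈ S) :
    amplitude g n C
      = ∑ p ∈ S, C p • (esymmProd n p * (esymm (Fin n) ℚ 1) ^ (3 * g + n - 3 - p.sum)) := by
  refine finsum_eq_sum_of_support_subset _ fun p hp => hS p fun h => hp ?_
  simp [h]

/-- A partition with parts less than `N` and size at most `M` has all multiplicities at most `M`. -/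
lemma le_nsmul_range {N M : ℕ} {p : Multiset ℕ} (hp : ∀ a ∈ p, 1 ≤ a ∧ a < N)
    (hM : p.sum ≤ M) : p ≤ M • Multiset.range N := by
  refine Multiset.le_iff_count.2 fun a => ?_
  by_cases ha : a ∈ p
  · have h1 : 1 ≤ (Multiset.range N).count a :=
      Multiset.one_le_count_iff_mem.2 (Multiset.mem_range.2 (hp a ha).2)
    have h2 : p.card ≤ p.sum := by
      simpa using Multiset.card_nsmul_le_sum (s := p) (a := 1) fun a ha => (hp a ha).1
    rw [Multiset.count_nsmul]
    calc p.count a ≤ M := (Multiset.count_le_card a p).trans (h2.trans hM)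
      _ ≤ M * (Multiset.range N).count a := Nat.le_mul_of_pos_right _ h1
  · simp [Multiset.count_eq_zero_of_notMem ha]

/-- The string equation implies the coefficients `C_n(λ)` are independent of `n`. -/
theorem string_coeff_stable (g : ℕ) (C : ℕ → Multiset ℕ → ℚ)
    (hvan : ∀ n, 1 ≤ n → 3 ≤ 3 * g + n → ∀ p : Multiset ℕ,
      ¬ ((∀ a ∈ p, 2 ≤ a ∧ a ≤ n) ∧ p.sum + 3 ≤ 3 * g + n) → C n p = 0)
    (hstring : ∀ n, 1 ≤ n → 3 ≤ 3 * g + n →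
      setLastZero n (amplitude g (n + 1) (C (n + 1)))
        = esymm (Fin n) ℚ 1 * amplitude g n (C n)) :
    ∀ n, 1 ≤ n → 3 ≤ 3 * g + n → ∀ p : Multiset ℕ,
      (∀ a ∈ p, 2 ≤ a ∧ a ≤ n) → p.sum + 3 ≤ 3 * g + n →
      C (n + 1) p = C n p := by
  intro n hn hg p hp hpsum
  have hvan' := hvan (n + 1) (by omega) (by omega)
  set M := 3 * g + n - 2 with hM
  set S : Finset (Multiset ℕ) := Finset.Iic (M • Multiset.range (n + 2)) with hS
  have hmem : ∀ q : Multiset ℕ, (∀ a ∈ q, 2 ≤ a ∧ a ≤ n + 1) → q.sum ≤ M → q ∈ S :=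
    fun q hq hqM => Finset.mem_Iic.2 <| le_nsmul_range
      (fun a ha => ⟨by linarith [(hq a ha).1], by linarith [(hq a ha).2]⟩) hqM
  have hS₀ : ∀ q, C n q ≠ 0 → q ∈ S := fun q hq => by
    have h := not_imp_comm.1 (hvan n hn hg q) hq
    exact hmem q (fun a ha => ⟨(h.1 a ha).1, by linarith [(h.1 a ha).2]⟩) (by omega)
  have hS₁ : ∀ q, C (n + 1) q ≠ 0 → q ∈ S := fun q hq => by
    have h := not_imp_comm.1 (hvan' q) hq
    exact hmem q h.1 (by omega)
  have heq := hstring n hn hg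
  rw [amplitude_eq_sum g n _ S hS₀, amplitude_eq_sum g (n + 1) _ S hS₁, map_sum,
    Finset.mul_sum, ← sub_eq_zero, ← Finset.sum_sub_distrib] at heq
  have hterm : ∀ q ∈ S,
      setLastZero n (C (n + 1) q • (esymmProd (n + 1) q *
        esymm (Fin (n + 1)) ℚ 1 ^ (3 * g + (n + 1) - 3 - q.sum)))
      - esymm (Fin n) ℚ 1 * C n q • (esymmProd n q *
        esymm (Fin n) ℚ 1 ^ (3 * g + n - 3 - q.sum))
      = (C (n + 1) q - C n q) • (esymmProd n q * esymm (Fin n) ℚ 1 ^ (M - q.sum)) := by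
    intro q _
    rw [map_smul, map_mul, map_pow, setLastZero_esymmProd, setLastZero_esymm, sub_smul,
      show 3 * g + (n + 1) - 3 - q.sum = M - q.sum by omega]
    congr 1
    by_cases hq : C n q = 0
    · simp [hq]
    · have h := (not_imp_comm.1 (hvan n hn hg q) hq).2
      rw [show M - q.sum = 3 * g + n - 3 - q.sum + 1 by omega, pow_succ, mul_smul_comm]
      congr 1
      ring
  classical
  rw [Finset.sum_congr rfl hterm,
    ← Finset.sum_filter_of_ne (p := fun q => ∀ a ∈ q, 2 ≤ a ∧ a ≤ n)] at heq
  · refine sub_eq_zero.1 (linearIndepOn_iff'.1 (linearIndepOn_esymmProd_mul_pow hn M) _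
      (fun q => C (n + 1) q - C n q) (fun q hq => (Finset.mem_filter.1 hq).2) heq p ?_)
    exact Finset.mem_filter.2
      ⟨hmem p (fun a ha => ⟨(hp a ha).1, by linarith [(hp a ha).2]⟩) (by omega), hp⟩
  · intro q _ hne a ha
    have han : a ≤ n := by
      by_contra! h
      exact hne (by rw [esymmProd_eq_zero ha h, zero_mul, smul_zero])
    refine ⟨?_, han⟩
    by_contra! h
    refine hne ?_
    rw [hvan' q fun h' => by linarith [(h'.1 a ha).1],
      hvan n hn hg q fun h' => by linarith [(h'.1 a ha).1], sub_zero, zero_smul]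
end

section
/- Fix an integer g ≥ 1. Let C be a function from partitions to ℚ that vanishes on every partition λ unless all parts of λ are ≥ 2 and |λ| − max(λ) ≤ 3g−3, and suppose C satisfies the dilaton recursion at genus g: for every partition λ with all parts ≥ 2, Σ_{a ∈ distinct parts of λ} (m_{a+1}(λ)+1)·C(λ∖{a} ∪ {a+1}) + (m_2(λ)+1)·C(λ ∪ {2}) + (g−|λ|)·C(λ) = 0. Then for every partition μ with all parts ≥ 2 and |μ| ≤ 3g−3, there exists a polynomial Q ∈ ℚ[X] of degree at most 3g−3−|μ| such that for every integer k > 3g−3−|μ|+μ_1−δ (where μ_1 := max(μ) if μ is nonempty and μ_1 := 2 if μ = ∅, and δ := 1 if |μ| = 3g−3 and δ := 0 otherwise), one has C(μ ∪ {k}) = (k+|μ|−g−1)!·Q(k). In particular, when |μ| = 3g−3 the normalized values C(μ ∪ {k})/(k+|μ|−g−1)! are constant in k for k ≥ μ_1. -/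
open Polynomial in
/-- Every rational polynomial of degree at most `n` is the forward difference of a polynomial
of degree at most `n + 1`. -/
theorem exists_eval_add_one_sub_eval_eq (n : ℕ) (P : ℚ[X]) (hP : P.natDegree ≤ n) :
    ∃ Q : ℚ[X], Q.natDegree ≤ n + 1 ∧ ∀ x : ℚ, Q.eval (x + 1) - Q.eval x = P.eval x := by
  refine ⟨∑ i ∈ Finset.range (n + 1), C (P.coeff i / (i + 1)) * Polynomial.bernoulli (i + 1), ?_, ?_⟩
  · refine natDegree_sum_le_of_forall_le _ _ fun i hi => (natDegree_C_mul_le _ _).trans ?_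
    rw [natDegree_le_iff_coeff_eq_zero]
    intro N hN
    rw [coeff_bernoulli, if_neg]
    have := Finset.mem_range.1 hi
    omega
  · intro x
    rw [eval_eq_sum_range' (Nat.lt_succ_of_le hP), eval_finsetSum, eval_finsetSum,
      ← Finset.sum_sub_distrib]
    refine Finset.sum_congr rfl fun i _ => ?_
    have hi : (i : ℚ) + 1 ≠ 0 := by positivity
    rw [eval_mul, eval_mul, eval_C, eval_C, add_comm x 1, bernoulli_eval_one_add]
    push_cast
    field_simp
    ring

open Polynomial in
/-- A sequence whose forward differences are eventually given by a polynomial of degree at most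
`n` is eventually given by a polynomial of degree at most `n + 1`. -/
theorem exists_eval_eq_of_forward_difference (n N : ℕ) (P : ℚ[X]) (hP : P.natDegree ≤ n)
    (F : ℕ → ℚ) (hF : ∀ k, N ≤ k → F (k + 1) - F k = P.eval (k : ℚ)) :
    ∃ Q : ℚ[X], Q.natDegree ≤ n + 1 ∧ ∀ k, N ≤ k → F k = Q.eval (k : ℚ) := by
  obtain ⟨Q, hQ, hdiff⟩ := exists_eval_add_one_sub_eval_eq n P hP
  refine ⟨Q + C (F N - Q.eval (N : ℚ)), ?_, fun k hk => ?_⟩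
  · rwa [natDegree_add_C]
  · induction k, hk using Nat.le_induction with
    | base => simp
    | succ k hk ih =>
      have h₁ := hF k hk
      have h₂ := hdiff k
      simp only [eval_add, eval_C] at ih ⊢
      push_cast
      linarith

section Dilaton

variable {g : ℕ} {C : Multiset ℕ → ℚ}

/-- The support condition in terms of a partition with a distinguished largest part. -/
theorem eq_zero_of_largest_part
    (hvan : ∀ p : Multiset ℕ,
      ¬ ((∀ a ∈ p, 2 ≤ a) ∧ p.sum + 3 ≤ 3 * g + p.sup) → C p = 0)
    {ν : Multiset ℕ} {k : ℕ} (hk : ∀ a ∈ ν, a ≤ k) (hsum : 3 * g < ν.sum + 3) :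
    C (k ::ₘ ν) = 0 := by
  refine hvan _ fun h => ?_
  have h₂ := h.2
  rw [Multiset.sup_cons, sup_eq_left.2 (Multiset.sup_le.2 hk), Multiset.sum_cons] at h₂
  omega

theorem Multiset.sum_cons_succ_erase {μ : Multiset ℕ} {a : ℕ} (ha : a ∈ μ) :
    ((a + 1) ::ₘ μ.erase a).sum = μ.sum + 1 := by
  have := Multiset.sum_erase ha
  rw [Multiset.sum_cons]
  omega

/-- On the boundary `|μ| = 3g - 3` the recursion has only two terms. -/
theorem dilaton_boundary_succ
    (hvan : ∀ p : Multiset ℕ,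
      ¬ ((∀ a ∈ p, 2 ≤ a) ∧ p.sum + 3 ≤ 3 * g + p.sup) → C p = 0)
    (hrec : ∀ p : Multiset ℕ, (∀ a ∈ p, 2 ≤ a) →
      (∑ a ∈ p.toFinset, ((p.count (a + 1) : ℚ) + 1) * C ((a + 1) ::ₘ p.erase a))
        + ((p.count 2 : ℚ) + 1) * C (2 ::ₘ p)
        + ((g : ℚ) - (p.sum : ℚ)) * C p = 0)
    {μ : Multiset ℕ} (hμ : ∀ a ∈ μ, 2 ≤ a) (hsum : μ.sum + 3 = 3 * g)
    {k : ℕ} (hk : 2 ≤ k) (hmax : ∀ a ∈ μ, a ≤ k) :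
    C ((k + 1) ::ₘ μ) = ((k : ℚ) + μ.sum - g) * C (k ::ₘ μ) := by
  have h := hrec (k ::ₘ μ) (by simpa [hk] using hμ)
  have hcount : (k ::ₘ μ).count (k + 1) = 0 := by
    rw [Multiset.count_eq_zero, Multiset.mem_cons]
    rintro (h | h)
    · omega
    · have := hmax _ h
      omega
  rw [Finset.sum_eq_single k, Multiset.erase_cons_head, hcount, Multiset.cons_swap,
    eq_zero_of_largest_part hvan (ν := 2 ::ₘ μ), Multiset.sum_cons] at h
  · simp only [Nat.cast_add, Nat.cast_zero] at h
    linarith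
  · simpa [hk] using hmax
  · rw [Multiset.sum_cons]
    omega
  · intro a ha hak
    have ha : a ∈ μ := by simpa [hak] using ha
    have hle := hmax a ha
    rw [Multiset.erase_cons_tail _ hak.symm, Multiset.cons_swap,
      eq_zero_of_largest_part hvan, mul_zero]
    · intro b hb
      rcases Multiset.mem_cons.1 hb with rfl | hb
      · omega
      · exact hmax b (Multiset.mem_of_mem_erase hb)
    · rw [Multiset.sum_cons_succ_erase ha]
      omega
  · simp

/-- On the boundary `|μ| = 3g - 3` the normalized values are constant. -/
theorem dilaton_boundary_normalized
    (hvan : ∀ p : Multiset ℕ,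
      ¬ ((∀ a ∈ p, 2 ≤ a) ∧ p.sum + 3 ≤ 3 * g + p.sup) → C p = 0)
    (hrec : ∀ p : Multiset ℕ, (∀ a ∈ p, 2 ≤ a) →
      (∑ a ∈ p.toFinset, ((p.count (a + 1) : ℚ) + 1) * C ((a + 1) ::ₘ p.erase a))
        + ((p.count 2 : ℚ) + 1) * C (2 ::ₘ p)
        + ((g : ℚ) - (p.sum : ℚ)) * C p = 0)
    {μ : Multiset ℕ} (hμ : ∀ a ∈ μ, 2 ≤ a) (hsum : μ.sum + 3 = 3 * g)
    {m : ℕ} (hm : 2 ≤ m) (hmax : ∀ a ∈ μ, a ≤ m) {k : ℕ} (hk : m ≤ k) :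
    C (k ::ₘ μ) / ((k + μ.sum - g - 1).factorial : ℚ)
      = C (m ::ₘ μ) / ((m + μ.sum - g - 1).factorial : ℚ) := by
  induction k, hk using Nat.le_induction with
  | base => rfl
  | succ k hk ih =>
    rw [← ih, dilaton_boundary_succ hvan hrec hμ hsum (hm.trans hk)
      fun a ha => (hmax a ha).trans hk]
    obtain ⟨j, hj⟩ : ∃ j, k + μ.sum = g + 1 + j := Nat.exists_eq_add_of_le (by omega)
    have hcast : (k : ℚ) + μ.sum = g + 1 + j := by exact_mod_cast hj
    rw [show k + 1 + μ.sum - g - 1 = j + 1 by omega, show k + μ.sum - g - 1 = j by omega,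
      hcast, Nat.factorial_succ]
    have hfac : (j.factorial : ℚ) ≠ 0 := by positivity
    have hj₁ : (j : ℚ) + 1 ≠ 0 := by positivity
    push_cast
    field_simp
    ring

/-- The recursion for a partition with a part exceeding all others by at least two, where the
multiplicities no longer see the large part. -/
theorem dilaton_large_part
    (hrec : ∀ p : Multiset ℕ, (∀ a ∈ p, 2 ≤ a) →
      (∑ a ∈ p.toFinset, ((p.count (a + 1) : ℚ) + 1) * C ((a + 1) ::ₘ p.erase a))
        + ((p.count 2 : ℚ) + 1) * C (2 ::ₘ p)
        + ((g : ℚ) - (p.sum : ℚ)) * C p = 0)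
    {μ : Multiset ℕ} (hμ : ∀ a ∈ μ, 2 ≤ a) {k : ℕ} (hk : 2 < k) (hmax : ∀ a ∈ μ, a + 1 < k) :
    C ((k + 1) ::ₘ μ)
      + ∑ a ∈ μ.toFinset, ((μ.count (a + 1) : ℚ) + 1) * C (k ::ₘ (a + 1) ::ₘ μ.erase a)
      + ((μ.count 2 : ℚ) + 1) * C (k ::ₘ 2 ::ₘ μ)
      + ((g : ℚ) - k - μ.sum) * C (k ::ₘ μ) = 0 := by
  have h := hrec (k ::ₘ μ) (by simpa [hk.le] using hμ)
  have hkμ : k ∉ μ := fun hmem => by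
    have := hmax k hmem
    omega
  have hkμ' : k + 1 ∉ μ := fun hmem => by
    have := hmax _ hmem
    omega
  rw [Multiset.toFinset_cons, Finset.sum_insert (by simpa using hkμ), Multiset.erase_cons_head,
    Multiset.count_cons_of_ne (by omega), Multiset.count_eq_zero.2 hkμ',
    Multiset.count_cons_of_ne (by omega), Multiset.cons_swap 2, Multiset.sum_cons,
    Finset.sum_congr rfl (g := fun a =>
      ((μ.count (a + 1) : ℚ) + 1) * C (k ::ₘ (a + 1) ::ₘ μ.erase a))] at h
  · simp only [Nat.cast_add, Nat.cast_zero] at h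
    linarith
  · intro a ha
    have := hmax a (Multiset.mem_toFinset.1 ha)
    rw [Multiset.count_cons_of_ne (by omega), Multiset.erase_cons_tail _ (by omega),
      Multiset.cons_swap]

open Polynomial in
/-- Polynomiality of the normalized values, with an arbitrary bound `m` on the parts of `μ`. -/
theorem exists_polynomial_of_dilaton
    (hvan : ∀ p : Multiset ℕ,
      ¬ ((∀ a ∈ p, 2 ≤ a) ∧ p.sum + 3 ≤ 3 * g + p.sup) → C p = 0)
    (hrec : ∀ p : Multiset ℕ, (∀ a ∈ p, 2 ≤ a) →
      (∑ a ∈ p.toFinset, ((p.count (a + 1) : ℚ) + 1) * C ((a + 1) ::ₘ p.erase a))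
        + ((p.count 2 : ℚ) + 1) * C (2 ::ₘ p)
        + ((g : ℚ) - (p.sum : ℚ)) * C p = 0)
    (d : ℕ) {μ : Multiset ℕ} (hμ : ∀ a ∈ μ, 2 ≤ a) (hsum : μ.sum + d + 3 = 3 * g)
    {m : ℕ} (hm : 2 ≤ m) (hmax : ∀ a ∈ μ, a ≤ m) :
    ∃ Q : ℚ[X], Q.natDegree ≤ d ∧ ∀ k : ℕ, m + d < k + (if d = 0 then 1 else 0) →
      C (k ::ₘ μ) = ((k + μ.sum - g - 1).factorial : ℚ) * Q.eval (k : ℚ) := by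
  induction d using Nat.strong_induction_on generalizing μ m with
  | _ d ih =>
  obtain _ | d := d
  · refine ⟨Polynomial.C (C (m ::ₘ μ) / ((m + μ.sum - g - 1).factorial : ℚ)), by simp,
      fun k hk => ?_⟩
    have hfac : ((k + μ.sum - g - 1).factorial : ℚ) ≠ 0 := by positivity
    rw [eval_C, ← dilaton_boundary_normalized hvan hrec hμ hsum hm hmax (k := k)
      (by simpa [Nat.lt_succ_iff] using hk)]
    field_simp
  have hraise : ∀ a ∈ μ, ∃ Q : ℚ[X], Q.natDegree ≤ d ∧ ∀ k : ℕ, m + 1 + d < k →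
      C (k ::ₘ (a + 1) ::ₘ μ.erase a) = ((k + μ.sum - g).factorial : ℚ) * Q.eval (k : ℚ) := by
    intro a ha
    obtain ⟨Q, hQ, h⟩ := ih d d.lt_succ_self (μ := (a + 1) ::ₘ μ.erase a)
      (by
        intro b hb
        rcases Multiset.mem_cons.1 hb with rfl | hb
        · exact (hμ a ha).trans a.le_succ
        · exact hμ b (Multiset.mem_of_mem_erase hb))
      (by
        rw [Multiset.sum_cons_succ_erase ha]
        omega)
      (show 2 ≤ m + 1 by omega)
      (by
        intro b hb
        rcases Multiset.mem_cons.1 hb with rfl | hb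
        · exact Nat.succ_le_succ (hmax a ha)
        · exact (hmax b (Multiset.mem_of_mem_erase hb)).trans m.le_succ)
    refine ⟨Q, hQ, fun k hk => ?_⟩
    rw [h k (by omega), Multiset.sum_cons_succ_erase ha,
      show k + (μ.sum + 1) - g - 1 = k + μ.sum - g by omega]
  have hadd : ∃ R : ℚ[X], R.natDegree ≤ d ∧ ∀ k : ℕ, m + 1 + d < k →
      C (k ::ₘ 2 ::ₘ μ) = ((k + μ.sum - g).factorial : ℚ) * R.eval (k : ℚ) := by
    obtain _ | e := d
    · refine ⟨0, by simp, fun k hk => ?_⟩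
      rw [eq_zero_of_largest_part hvan]
      · simp
      · intro b hb
        rcases Multiset.mem_cons.1 hb with rfl | hb
        · omega
        · exact (hmax b hb).trans (by omega)
      · rw [Multiset.sum_cons]
        omega
    · obtain ⟨Q, hQ, h⟩ := ih e (by omega) (μ := 2 ::ₘ μ)
        (by simpa using hμ)
        (by
          rw [Multiset.sum_cons]
          omega)
        hm (by simpa [hm] using hmax)
      refine ⟨Q * (X + Polynomial.C ((μ.sum : ℚ) + 1 - g)),
        natDegree_mul_le_of_le hQ (natDegree_X_add_C _).le, fun k hk => ?_⟩
      obtain ⟨j, hj⟩ : ∃ j, k + μ.sum = g + j := Nat.exists_eq_add_of_le (by omega)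
      have hcast : (k : ℚ) + μ.sum = g + j := by exact_mod_cast hj
      rw [h k (by omega), Multiset.sum_cons,
        show k + (2 + μ.sum) - g - 1 = j + 1 by omega, show k + μ.sum - g = j by omega,
        Nat.factorial_succ, eval_mul, eval_add, eval_X, eval_C,
        show (k : ℚ) + (μ.sum + 1 - g) = j + 1 by linarith]
      push_cast
      ring
  choose! Q hQdeg hQ using hraise
  obtain ⟨R, hRdeg, hR⟩ := hadd
  obtain ⟨S, hSdeg, hS⟩ := exists_eval_eq_of_forward_difference d (m + d + 2)
    (-(∑ a ∈ μ.toFinset, Polynomial.C ((μ.count (a + 1) : ℚ) + 1) * Q a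
      + Polynomial.C ((μ.count 2 : ℚ) + 1) * R))
    (by
      rw [natDegree_neg]
      refine natDegree_add_le_of_degree_le
        (natDegree_sum_le_of_forall_le _ _ fun a ha => ?_) ?_
      · exact (natDegree_C_mul_le _ _).trans (hQdeg a (Multiset.mem_toFinset.1 ha))
      · exact (natDegree_C_mul_le _ _).trans hRdeg)
    (fun k => C (k ::ₘ μ) / ((k + μ.sum - g - 1).factorial : ℚ))
    (by
      intro k hk
      have h := dilaton_large_part hrec hμ (k := k) (by omega) fun a ha => by
        have := hmax a ha
        omega
      obtain ⟨j, hj⟩ : ∃ j, k + μ.sum = g + 1 + j := Nat.exists_eq_add_of_le (by omega)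
      have hcast : (k : ℚ) + μ.sum = g + 1 + j := by exact_mod_cast hj
      have hsub : k + μ.sum - g = j + 1 := by omega
      rw [hR k (by omega), Finset.sum_congr rfl (g := fun a => ((j + 1).factorial : ℚ) *
        (((μ.count (a + 1) : ℚ) + 1) * (Q a).eval (k : ℚ))), ← Finset.mul_sum, hsub,
        show (g : ℚ) - k - μ.sum = -(j + 1) by linarith] at h
      · simp only [eval_neg, eval_add, eval_finsetSum, eval_mul, eval_C]
        rw [show k + 1 + μ.sum - g - 1 = j + 1 by omega, show k + μ.sum - g - 1 = j by omega]
        rw [Nat.factorial_succ] at h ⊢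
        have hfac : (j.factorial : ℚ) ≠ 0 := by positivity
        have hj₁ : (j : ℚ) + 1 ≠ 0 := by positivity
        push_cast at h ⊢
        field_simp
        linarith
      · intro a ha
        rw [hQ a (Multiset.mem_toFinset.1 ha) k (by omega), hsub]
        ring)
  refine ⟨S, hSdeg, fun k hk => ?_⟩
  have hfac : ((k + μ.sum - g - 1).factorial : ℚ) ≠ 0 := by positivity
  rw [← hS k (by simp at hk; omega)]
  field_simp

end Dilaton


/-- Lemma 3.5 and Corollary 3.6 of the paper: if the coefficients `C(λ)` are
supported on partitions with all parts `≥ 2` and `|λ| − max(λ) ≤ 3g−3` and satisfy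
the dilaton recursion at genus `g`, then for every partition `μ` with parts `≥ 2`
and `|μ| ≤ 3g−3`, the values `C(μ ∪ {k})` are, for
`k > 3g−3−|μ|+μ₁−δ` (with `μ₁ = max(μ)` or `2` for `μ = ∅`, and `δ = 1` iff
`|μ| = 3g−3`), of the form `(k+|μ|−g−1)! · Q(k)` for a polynomial `Q` of degree at
most `3g−3−|μ|`.  In particular for `|μ| = 3g−3` the normalized values
`C(μ ∪ {k})/(k+|μ|−g−1)!` are constant for `k ≥ μ₁`. -/
theorem dilaton_recursion_polynomiality (g : ℕ) (hg : 1 ≤ g) (C : Multiset ℕ → ℚ)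
    (hvan : ∀ p : Multiset ℕ,
      ¬ ((∀ a ∈ p, 2 ≤ a) ∧ p.sum + 3 ≤ 3 * g + p.sup) → C p = 0)
    (hrec : ∀ p : Multiset ℕ, (∀ a ∈ p, 2 ≤ a) →
      (∑ a ∈ p.toFinset, ((p.count (a + 1) : ℚ) + 1) * C ((a + 1) ::ₘ p.erase a))
        + ((p.count 2 : ℚ) + 1) * C (2 ::ₘ p)
        + ((g : ℚ) - (p.sum : ℚ)) * C p = 0) :
    ∀ μ : Multiset ℕ, (∀ a ∈ μ, 2 ≤ a) → μ.sum + 3 ≤ 3 * g →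
      ∃ Q : Polynomial ℚ, Q.natDegree ≤ 3 * g - 3 - μ.sum ∧
        (∀ k : ℕ,
          3 * g - 3 - μ.sum + (if μ = 0 then 2 else μ.sup)
              - (if μ.sum + 3 = 3 * g then 1 else 0) < k →
          C (k ::ₘ μ) = ((k + μ.sum - g - 1).factorial : ℚ) * Q.eval (k : ℚ)) ∧
        (μ.sum + 3 = 3 * g → ∀ k : ℕ, (if μ = 0 then 2 else μ.sup) ≤ k →
          C (k ::ₘ μ) / ((k + μ.sum - g - 1).factorial : ℚ)
            = C ((if μ = 0 then 2 else μ.sup) ::ₘ μ) /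
                (((if μ = 0 then 2 else μ.sup) + μ.sum - g - 1).factorial : ℚ)) := by
  intro μ hμ hsum
  obtain ⟨hm, hmax⟩ : 2 ≤ (if μ = 0 then 2 else μ.sup) ∧
      ∀ a ∈ μ, a ≤ (if μ = 0 then 2 else μ.sup) := by
    split_ifs with h
    · simp [h]
    · obtain ⟨a, ha⟩ := Multiset.exists_mem_of_ne_zero h
      exact ⟨(hμ a ha).trans (Multiset.le_sup ha), fun b hb => Multiset.le_sup hb⟩
  generalize (if μ = 0 then 2 else μ.sup) = m at hm hmax ⊢
  obtain ⟨Q, hQ, h⟩ := exists_polynomial_of_dilaton hvan hrec (3 * g - 3 - μ.sum) hμ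
    (by omega) hm hmax
  refine ⟨Q, hQ, fun k hk => h k ?_, fun hμg k hk =>
    dilaton_boundary_normalized hvan hrec hμ hμg hm hmax hk⟩
  split_ifs at hk ⊢ <;> omega
end

section
/- Let C be a function from partitions to ℚ that vanishes on every partition λ unless all parts of λ are ≥ 2 and |λ| − max(λ) ≤ 0 (i.e., λ is empty or consists of a single part), suppose C satisfies the dilaton recursion at genus g = 1: for every partition λ with all parts ≥ 2, Σ_{a ∈ distinct parts of λ} (m_{a+1}(λ)+1)·C(λ∖{a} ∪ {a+1}) + (m_2(λ)+1)·C(λ ∪ {2}) + (1−|λ|)·C(λ) = 0, and suppose C(∅) = 1/24. Then C({k}) = −(k−2)!/24 for every integer k ≥ 2. Consequently the genus-one amplitude satisfies 24·A_{1,n} = e_1^n − Σ_{k=2}^{n} (k−2)!·e_k·e_1^{n−k}. -/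
open MvPolynomial

/-- The genus-one amplitude `A_{1,n} = Σ_λ C(λ) · e_λ · e_1 ^ (n−|λ|)`. -/
noncomputable def amplitudeOne (n : ℕ) (C : Multiset ℕ → ℚ) :
    MvPolynomial (Fin n) ℚ :=
  ∑ᶠ p : Multiset ℕ,
    C p • (esymmProd n p * (esymm (Fin n) ℚ 1) ^ (n - p.sum))

theorem Multiset.sup_le_sum_nat (p : Multiset ℕ) : p.sup ≤ p.sum :=
  Multiset.sup_le.2 fun _ ha => Multiset.le_sum_of_mem ha

/-- A multiset of positive integers whose sum is at most its largest element
has at most one element. -/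
theorem Multiset.eq_zero_or_singleton_of_sum_le_sup {p : Multiset ℕ}
    (hpos : ∀ a ∈ p, 0 < a) (h : p.sum ≤ p.sup) : p = 0 ∨ ∃ k, p = {k} := by
  rcases p.empty_or_exists_mem with rfl | ⟨a, ha⟩
  · exact Or.inl rfl
  obtain ⟨q, rfl⟩ := Multiset.exists_cons_of_mem ha
  have ha0 := hpos a ha
  rw [Multiset.sum_cons, Multiset.sup_cons] at h
  have hq := q.sup_le_sum_nat
  have hq0 : q.sum = 0 := by
    rcases le_sup_iff.1 h with h | h <;> omega
  rcases q.empty_or_exists_mem with rfl | ⟨b, hb⟩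
  · exact Or.inr ⟨a, rfl⟩
  · have := Multiset.le_sum_of_mem hb
    have := hpos b (Multiset.mem_cons_of_mem hb)
    omega

theorem MvPolynomial.esymm_fin_eq_zero_of_lt {R : Type*} [CommSemiring R] {n k : ℕ}
    (h : n < k) : esymm (Fin n) R k = 0 := by
  rw [esymm, Finset.powersetCard_eq_empty.2 (by simpa using h), Finset.sum_empty]

/-- If `C` is supported on the empty partition and the one-part partitions with part
`≥ 2`, then the amplitude is a sum over parts `k ≤ n`. -/
theorem amplitudeOne_eq_of_support (n : ℕ) (C : Multiset ℕ → ℚ)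
    (hC : ∀ p, C p ≠ 0 → p = 0 ∨ ∃ k, 2 ≤ k ∧ p = {k}) :
    amplitudeOne n C = C 0 • esymm (Fin n) ℚ 1 ^ n
      + ∑ k ∈ Finset.Icc 2 n,
          C {k} • (esymm (Fin n) ℚ k * esymm (Fin n) ℚ 1 ^ (n - k)) := by
  classical
  rw [amplitudeOne, finsum_eq_sum_of_support_subset
    (s := insert 0 ((Finset.Icc 2 n).image fun k => ({k} : Multiset ℕ)))]
  · rw [Finset.sum_insert (by simp), Finset.sum_image (by simp)]
    simp [esymmProd]
  · intro p hp
    rw [Function.mem_support] at hp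
    rcases hC p (left_ne_zero_of_smul hp) with rfl | ⟨k, hk, rfl⟩
    · simp
    · have hkn : k ≤ n := by
        by_contra! hlt
        exact hp (by simp [esymmProd, esymm_fin_eq_zero_of_lt hlt])
      simp [hk, hkn]

/-- Genus one: if `C` is supported on partitions with parts `≥ 2` and
`|λ| − max(λ) ≤ 0` (so `λ = ∅` or a single part), satisfies the dilaton
recursion at `g = 1`, and `C(∅) = 1/24`, then `C({k}) = −(k−2)!/24` for `k ≥ 2`,
and consequently `24·A_{1,n} = e_1^n − Σ_{k=2}^n (k−2)!·e_k·e_1^{n−k}`. -/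
theorem genus_one_formula (C : Multiset ℕ → ℚ)
    (hvan : ∀ p : Multiset ℕ,
      ¬ ((∀ a ∈ p, 2 ≤ a) ∧ p.sum ≤ p.sup) → C p = 0)
    (hrec : ∀ p : Multiset ℕ, (∀ a ∈ p, 2 ≤ a) →
      (∑ a ∈ p.toFinset, ((p.count (a + 1) : ℚ) + 1) * C ((a + 1) ::ₘ p.erase a))
        + ((p.count 2 : ℚ) + 1) * C (2 ::ₘ p)
        + ((1 : ℚ) - (p.sum : ℚ)) * C p = 0)
    (hnorm : C 0 = 1 / 24) :
    (∀ k : ℕ, 2 ≤ k → C {k} = -((k - 2).factorial : ℚ) / 24) ∧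
    (∀ n : ℕ, 1 ≤ n →
      (24 : ℚ) • amplitudeOne n C
        = (esymm (Fin n) ℚ 1) ^ n
          - ∑ k ∈ Finset.Icc 2 n,
              ((k - 2).factorial : ℚ) •
                (esymm (Fin n) ℚ k * (esymm (Fin n) ℚ 1) ^ (n - k))) := by
  have hsupp : ∀ p, C p ≠ 0 → p = 0 ∨ ∃ k, 2 ≤ k ∧ p = {k} := by
    intro p hp
    obtain ⟨h2, hsum⟩ := not_not.1 (mt (hvan p) hp)
    rcases Multiset.eq_zero_or_singleton_of_sum_le_sup
      (fun a ha => two_pos.trans_le (h2 a ha)) hsum with rfl | ⟨k, rfl⟩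
    · exact Or.inl rfl
    · exact Or.inr ⟨k, h2 k (by simp), rfl⟩
  have hC : ∀ k : ℕ, 2 ≤ k → C {k} = -((k - 2).factorial : ℚ) / 24 := by
    intro k hk
    induction k, hk using Nat.le_induction with
    | base =>
      have h := hrec 0 (by simp)
      simp [hnorm] at h
      norm_num
      linarith
    | succ k hk ih =>
      have h := hrec {k} (by simpa using hk)
      have hpair : C (2 ::ₘ {k}) = 0 := hvan _ fun h => by
        have := h.2
        simp at this
        omega
      have herase : ({k} : Multiset ℕ).erase k = 0 := by simp
      simp [hpair, herase, ih, Multiset.count_singleton] at h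
      obtain ⟨m, rfl⟩ := Nat.exists_eq_add_of_le' hk
      rw [show m + 2 + 1 - 2 = m + 1 by omega, Nat.factorial_succ]
      simp at h
      push_cast at h ⊢
      linarith
  refine ⟨hC, fun n _ => ?_⟩
  rw [amplitudeOne_eq_of_support n C hsupp, hnorm, smul_add, smul_smul, Finset.smul_sum,
    sub_eq_add_neg, ← Finset.sum_neg_distrib]
  congr 1
  · norm_num
  · refine Finset.sum_congr rfl fun k hk => ?_
    rw [hC k (Finset.mem_Icc.1 hk).1, smul_smul, ← neg_smul]
    congr 1
    ring
end

section
/- For every integer g ≥ 2, the map sending a partition μ to the partition obtained by removing three parts equal to 2 from μ is a well-defined bijection from the set {μ a partition : all parts of μ are ≥ 2, |μ| ≤ 3g−3, and ℓ(μ) ≥ g} onto the set {ν a partition : all parts of ν are ≥ 2, |ν| ≤ 3g−9, and ℓ(ν) ≥ g−3}. In particular these two sets have the same cardinality. -/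
theorem Multiset.three_mul_card_le_sum_add_count_two (μ : Multiset ℕ) (h : ∀ a ∈ μ, 2 ≤ a) :
    3 * Multiset.card μ ≤ μ.sum + μ.count 2 := by
  induction μ using Multiset.induction_on with
  | empty => simp
  | cons a μ ih =>
    have ha := h a (Multiset.mem_cons_self a μ)
    have hμ := ih fun b hb => h b (Multiset.mem_cons_of_mem hb)
    rw [Multiset.card_cons, Multiset.sum_cons, Multiset.count_cons]
    split_ifs <;> omega

/-- For `g ≥ 2`, removing three parts equal to `2` is a well-defined bijection
from `{μ : all parts ≥ 2, |μ| ≤ 3g−3, ℓ(μ) ≥ g}` onto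
`{ν : all parts ≥ 2, |ν| ≤ 3g−9, ℓ(ν) ≥ g−3}`; in particular the two sets
have the same cardinality. -/
theorem remove_three_twos_bijection (g : ℕ) (hg : 2 ≤ g) :
    Set.BijOn (fun μ : Multiset ℕ => μ - Multiset.replicate 3 2)
      {μ : Multiset ℕ | (∀ a ∈ μ, 2 ≤ a) ∧ μ.sum + 3 ≤ 3 * g ∧ g ≤ Multiset.card μ}
      {ν : Multiset ℕ | (∀ a ∈ ν, 2 ≤ a) ∧ ν.sum + 9 ≤ 3 * g ∧ g ≤ Multiset.card ν + 3}
    ∧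
    Set.ncard {μ : Multiset ℕ | (∀ a ∈ μ, 2 ≤ a) ∧ μ.sum + 3 ≤ 3 * g ∧ g ≤ Multiset.card μ}
      = Set.ncard {ν : Multiset ℕ | (∀ a ∈ ν, 2 ≤ a) ∧ ν.sum + 9 ≤ 3 * g ∧ g ≤ Multiset.card ν + 3} := by
  have hle : ∀ μ : Multiset ℕ,
      (∀ a ∈ μ, 2 ≤ a) ∧ μ.sum + 3 ≤ 3 * g ∧ g ≤ Multiset.card μ →
        Multiset.replicate 3 2 ≤ μ := by
    rintro μ ⟨h, hsum, hcard⟩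
    have := μ.three_mul_card_le_sum_add_count_two h
    exact Multiset.le_count_iff_replicate_le.mp (by omega)
  have hbij : Set.BijOn (fun μ : Multiset ℕ => μ - Multiset.replicate 3 2)
      {μ : Multiset ℕ | (∀ a ∈ μ, 2 ≤ a) ∧ μ.sum + 3 ≤ 3 * g ∧ g ≤ Multiset.card μ}
      {ν : Multiset ℕ | (∀ a ∈ ν, 2 ≤ a) ∧ ν.sum + 9 ≤ 3 * g ∧
        g ≤ Multiset.card ν + 3} := by
    refine ⟨fun μ hμ => ?_, fun μ hμ ν hν h => ?_, fun ν hν => ?_⟩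
    · obtain ⟨ν, rfl⟩ := Multiset.le_iff_exists_add.mp (hle μ hμ)
      obtain ⟨h, hsum, hcard⟩ := hμ
      simp only [add_tsub_cancel_left]
      rw [Multiset.sum_add, Multiset.sum_replicate, smul_eq_mul] at hsum
      rw [Multiset.card_add, Multiset.card_replicate] at hcard
      exact ⟨fun a ha => h a (Multiset.mem_add.mpr (Or.inr ha)), by omega, by omega⟩
    · exact (tsub_left_inj (hle μ hμ) (hle ν hν)).mp h
    · obtain ⟨h, hsum, hcard⟩ := hν
      refine ⟨ν + Multiset.replicate 3 2, ⟨fun a ha => ?_, ?_, ?_⟩, add_tsub_cancel_right _ _⟩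
      · rcases Multiset.mem_add.mp ha with ha | ha
        · exact h a ha
        · exact (Multiset.eq_of_mem_replicate ha).ge
      · rw [Multiset.sum_add, Multiset.sum_replicate, smul_eq_mul]
        omega
      · rwa [Multiset.card_add, Multiset.card_replicate]
  exact ⟨hbij, by rw [← hbij.image_eq, hbij.injOn.ncard_image]⟩
end

section
/- For every integer g ≥ 0, the following identity holds in the polynomial ring ℚ[X,Y]: Σ_{k=0}^{g} [ k! / ( (g−k)! · 24^{g−k} · (2k+1)! · 2^k ) ] · (X^3 − 3XY)^{g−k} · X^k · Y^k = (1/(24^g · g!)) · Σ_{m=0}^{g} binom(g,m) · ((−3)^m/(2m+1)) · X^{3g−2m} · Y^m. -/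
section BetaFunctional

variable {R : Type*} [CommRing R] [Algebra ℚ R]

/-- The `R`-linear functional `t ^ j ↦ 1 / (2 * j + 1)` on `R[t]`,
that is, `p ↦ ∫ s in 0..1, p (s ^ 2)`. -/
noncomputable def betaFunctional (R : Type*) [CommRing R] [Algebra ℚ R] :
    Polynomial R →ₗ[R] R :=
  Polynomial.lsum fun j => ((1 : ℚ) / (2 * j + 1)) • LinearMap.id

theorem betaFunctional_monomial (j : ℕ) (r : R) :
    betaFunctional R (Polynomial.monomial j r) = ((1 : ℚ) / (2 * j + 1)) • r := by
  simp [betaFunctional, Polynomial.lsum_apply, Polynomial.sum_monomial_index]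

/-- Integration by parts for `betaFunctional`. -/
theorem betaFunctional_add_derivative (p : Polynomial R) :
    betaFunctional R (p + 2 * Polynomial.X * Polynomial.derivative p) = p.eval 1 := by
  induction p using Polynomial.induction_on' with
  | add p q hp hq =>
    rw [Polynomial.eval_add, ← hp, ← hq, ← map_add, Polynomial.derivative_add]
    congr 1
    ring
  | monomial j r =>
    have h : Polynomial.monomial j r
        + 2 * Polynomial.X * Polynomial.derivative (Polynomial.monomial j r)
        = (2 * (j : ℚ) + 1) • Polynomial.monomial j r := by
      rcases j with _ | j
      · simp
      · rw [mul_assoc, Polynomial.X_mul, Polynomial.derivative_monomial,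
          Nat.add_sub_cancel, Polynomial.monomial_mul_X]
        simp only [Algebra.smul_def, map_add, map_mul, map_ofNat,
          map_natCast, map_one, ← Polynomial.C_mul_X_pow_eq_monomial]
        ring
    have hj : (2 * (j : ℚ) + 1) ≠ 0 := by positivity
    rw [h, Polynomial.smul_monomial, betaFunctional_monomial, smul_smul, one_div,
      inv_mul_cancel₀ hj, one_smul]
    simp

theorem betaFunctional_one_sub_X_pow (k : ℕ) :
    betaFunctional R ((1 - Polynomial.X) ^ k)
      = algebraMap ℚ R (4 ^ k * (k.factorial : ℚ) ^ 2 / (2 * k + 1).factorial) := by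
  induction k with
  | zero =>
    have h := betaFunctional_monomial (R := R) 0 1
    simpa using h
  | succ k ih =>
    have h := betaFunctional_add_derivative (R := R) ((1 - Polynomial.X) ^ (k + 1))
    have e : ((1 - Polynomial.X) ^ (k + 1) + 2 * Polynomial.X *
        Polynomial.derivative ((1 - Polynomial.X) ^ (k + 1)) : Polynomial R)
        = (2 * k + 3 : R) • (1 - Polynomial.X) ^ (k + 1)
          - (2 * (k + 1) : R) • (1 - Polynomial.X) ^ k := by
      simp only [Polynomial.derivative_pow_succ, Polynomial.smul_eq_C_mul, map_add, map_mul,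
        Polynomial.derivative_sub, Polynomial.derivative_one, Polynomial.derivative_X,
        map_natCast, map_one, map_ofNat]
      ring
    rw [e, map_sub, map_smul, map_smul, ih, smul_eq_mul, smul_eq_mul, Polynomial.eval_pow,
      Polynomial.eval_sub, Polynomial.eval_one, Polynomial.eval_X, sub_self,
      zero_pow k.succ_ne_zero, sub_eq_zero] at h
    have hk : (2 * (k : ℚ) + 3) ≠ 0 := by positivity
    have hc : (2 * k + 3 : R) = algebraMap ℚ R (2 * k + 3) := by simp [map_ofNat (algebraMap ℚ R)]
    have hd : (2 * (k + 1) : R) = algebraMap ℚ R (2 * (k + 1)) := by simp [map_ofNat (algebraMap ℚ R)]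
    have hu : algebraMap ℚ R (2 * k + 3)⁻¹ * algebraMap ℚ R (2 * k + 3) = 1 := by
      rw [← map_mul, inv_mul_cancel₀ hk, map_one]
    rw [← one_mul (betaFunctional R _), ← hu, mul_assoc, ← hc, h, hd, ← map_mul, ← map_mul]
    congr 1
    rw [show 2 * (k + 1) + 1 = (2 * k + 1) + 1 + 1 by ring, Nat.factorial_succ (2 * k + 1 + 1),
      Nat.factorial_succ (2 * k + 1), Nat.factorial_succ k]
    push_cast
    field_simp
    ring

theorem sum_choose_beta (A B : R) (g : ℕ) :
    ∑ k ∈ Finset.range (g + 1),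
      ((g.choose k : ℚ) * (4 ^ k * (k.factorial : ℚ) ^ 2 / (2 * k + 1).factorial)) •
        ((A - B) ^ (g - k) * B ^ k)
    = ∑ m ∈ Finset.range (g + 1),
        ((g.choose m : ℚ) * ((-1) ^ m / (2 * m + 1))) • (A ^ (g - m) * B ^ m) := by
  have h₁ : (Polynomial.C A - Polynomial.C B * Polynomial.X) ^ g
      = ∑ k ∈ Finset.range (g + 1), ((g.choose k : R) * ((A - B) ^ (g - k) * B ^ k)) •
          (1 - Polynomial.X : Polynomial R) ^ k := by
    rw [show Polynomial.C A - Polynomial.C B * Polynomial.X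
      = Polynomial.C B * (1 - Polynomial.X) + Polynomial.C (A - B) by rw [map_sub]; ring, add_pow]
    refine Finset.sum_congr rfl fun k _ => ?_
    simp only [Polynomial.smul_eq_C_mul, map_mul, map_pow, map_natCast, mul_pow]
    ring
  have h₂ : (Polynomial.C A - Polynomial.C B * Polynomial.X) ^ g
      = ∑ m ∈ Finset.range (g + 1),
          Polynomial.monomial m ((g.choose m : R) * ((-1) ^ m * (A ^ (g - m) * B ^ m))) := by
    rw [show Polynomial.C A - Polynomial.C B * Polynomial.X
      = -(Polynomial.C B * Polynomial.X) + Polynomial.C A by ring, add_pow]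
    refine Finset.sum_congr rfl fun k _ => ?_
    rw [← Polynomial.C_mul_X_pow_eq_monomial, neg_pow]
    simp only [map_mul, map_pow, map_natCast, map_neg, map_one]
    ring
  have h := congrArg (betaFunctional R) (h₁.symm.trans h₂)
  simp only [map_sum, map_smul, betaFunctional_one_sub_X_pow, betaFunctional_monomial] at h
  convert h using 2 with k _ m _
  · rw [smul_eq_mul, Algebra.smul_def, map_mul, map_natCast]
    ring
  · rw [div_eq_mul_one_div]
    simp only [Algebra.smul_def, map_mul, map_natCast, map_pow, map_neg, map_one]
    ring

end BetaFunctional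

open MvPolynomial

/-- The two-point identity (Section 4.2): in `ℚ[X,Y]` (with `X = X 0`, `Y = X 1`),
`Σ_{k=0}^{g} [k! / ((g−k)!·24^{g−k}·(2k+1)!·2^k)] · (X³−3XY)^{g−k} · X^k · Y^k
  = (1/(24^g·g!)) · Σ_{m=0}^{g} C(g,m)·((−3)^m/(2m+1)) · X^{3g−2m} · Y^m`. -/
theorem two_point_identity (g : ℕ) :
    (∑ k ∈ Finset.range (g + 1),
      ((k.factorial : ℚ) /
          ((g - k).factorial * 24 ^ (g - k) * (2 * k + 1).factorial * 2 ^ k)) •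
        (((X 0) ^ 3 - 3 * X 0 * X 1 : MvPolynomial (Fin 2) ℚ) ^ (g - k)
          * (X 0) ^ k * (X 1) ^ k))
    = ((1 : ℚ) / (24 ^ g * g.factorial)) •
        ∑ m ∈ Finset.range (g + 1),
          ((g.choose m : ℚ) * ((-3 : ℚ) ^ m / (2 * m + 1))) •
            ((X 0) ^ (3 * g - 2 * m) * (X 1) ^ m : MvPolynomial (Fin 2) ℚ) := by
  have h := congrArg (fun p => ((1 : ℚ) / (24 ^ g * g.factorial)) • (X 0 ^ g * p))
    (sum_choose_beta (X 0 ^ 2 : MvPolynomial (Fin 2) ℚ) (3 * X 1) g)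
  simp only [Finset.mul_sum] at h
  convert h using 1
  · rw [Finset.smul_sum]
    refine Finset.sum_congr rfl fun k hk => ?_
    obtain ⟨n, rfl⟩ := Nat.exists_eq_add_of_le (Finset.mem_range_succ_iff.mp hk)
    have e : (X 0 ^ (k + n) * ((X 0 ^ 2 - 3 * X 1) ^ n * (3 * X 1) ^ k) :
        MvPolynomial (Fin 2) ℚ)
        = (3 ^ k : ℚ) • ((X 0 ^ 3 - 3 * X 0 * X 1) ^ n * X 0 ^ k * X 1 ^ k) := by
      rw [Algebra.smul_def, map_pow, map_ofNat,
        show (X 0 ^ 3 - 3 * X 0 * X 1 : MvPolynomial (Fin 2) ℚ)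
          = X 0 * (X 0 ^ 2 - 3 * X 1) by ring, mul_pow (X 0)]
      ring
    rw [Nat.add_sub_cancel_left, mul_smul_comm, e, smul_smul, smul_smul,
      Nat.cast_add_choose]
    congr 1
    rw [pow_add, show (24 : ℚ) = 2 * 3 * 4 by norm_num, mul_pow _ _ k, mul_pow _ _ k]
    field_simp
  · congr 1
    refine Finset.sum_congr rfl fun m hm => ?_
    obtain ⟨n, rfl⟩ := Nat.exists_eq_add_of_le (Finset.mem_range_succ_iff.mp hm)
    have e : (X 0 ^ (m + n) * ((X 0 ^ 2) ^ n * (3 * X 1) ^ m) : MvPolynomial (Fin 2) ℚ)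
        = (3 ^ m : ℚ) • (X 0 ^ (m + 3 * n) * X 1 ^ m) := by
      rw [Algebra.smul_def, map_pow, map_ofNat]
      ring
    rw [Nat.add_sub_cancel_left, mul_smul_comm, e, smul_smul,
      show 3 * (m + n) - 2 * m = m + 3 * n by omega]
    congr 1
    rw [show (-3 : ℚ) = -1 * 3 by norm_num, mul_pow]
    ring
end

section
/- For every integer m ≥ 0: Σ_{k=0}^{m} (−4)^k · ( m! / (m−k)! ) · ( k! / (2k+1)! ) = 1/(2m+1), as an identity of rational numbers. -/
/-- Zeilberger-style recurrence for the partial sums of the Liu–Xu summand. -/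
theorem liu_xu_partial_sum_recurrence (m n : ℕ) (hn : n ≤ m + 1) :
    (2 * (m : ℚ) + 3) * ∑ k ∈ Finset.range n,
        (-4 : ℚ) ^ k * (((m + 1).factorial : ℚ) / ((m + 1 - k).factorial : ℚ))
          * ((k.factorial : ℚ) / ((2 * k + 1).factorial : ℚ))
      - (2 * (m : ℚ) + 1) * ∑ k ∈ Finset.range n,
        (-4 : ℚ) ^ k * ((m.factorial : ℚ) / ((m - k).factorial : ℚ))
          * ((k.factorial : ℚ) / ((2 * k + 1).factorial : ℚ))
    = -((n : ℚ) * (2 * n + 1)) * ((-4 : ℚ) ^ n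
        * ((m.factorial : ℚ) / ((m + 1 - n).factorial : ℚ))
        * ((n.factorial : ℚ) / ((2 * n + 1).factorial : ℚ))) := by
  induction n with
  | zero => simp
  | succ k ih =>
    obtain ⟨j, rfl⟩ : ∃ j, m = k + j := ⟨m - k, by omega⟩
    have ih := ih (by omega)
    rw [Finset.sum_range_succ, Finset.sum_range_succ, mul_add, mul_add, add_sub_add_comm, ih]
    have h₁ : k + j + 1 - k = j + 1 := by omega
    have h₂ : k + j - k = j := by omega
    have h₃ : k + j + 1 - (k + 1) = j := by omega
    have h₄ : 2 * (k + 1) + 1 = (2 * k + 1) + 1 + 1 := by ring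
    rw [h₁, h₂, h₃, h₄]
    have hj : (j.factorial : ℚ) ≠ 0 := by positivity
    have hk : ((2 * k + 1).factorial : ℚ) ≠ 0 := by positivity
    have hj' : (j : ℚ) + 1 ≠ 0 := by positivity
    have hk' : (2 * (k : ℚ) + 1 + 1) ≠ 0 := by positivity
    have hk'' : (2 * (k : ℚ) + 1 + 1 + 1) ≠ 0 := by positivity
    rw [Nat.factorial_succ (2 * k + 1 + 1), Nat.factorial_succ (2 * k + 1),
      Nat.factorial_succ j, Nat.factorial_succ (k + j), Nat.factorial_succ k]
    push_cast
    field_simp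
    ring


/-- The combinatorial identity (the `2r+n = 2` case of Liu–Xu, Lemma 2.6):
`Σ_{k=0}^{m} (−4)^k · (m!/(m−k)!) · (k!/(2k+1)!) = 1/(2m+1)`. -/
theorem liu_xu_identity (m : ℕ) :
    ∑ k ∈ Finset.range (m + 1),
      (-4 : ℚ) ^ k * ((m.factorial : ℚ) / ((m - k).factorial : ℚ))
        * ((k.factorial : ℚ) / ((2 * k + 1).factorial : ℚ))
    = 1 / (2 * (m : ℚ) + 1) := by
  induction m with
  | zero => simp
  | succ m ih =>
    have h := liu_xu_partial_sum_recurrence m (m + 1) le_rfl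
    rw [ih, mul_one_div_cancel (by positivity)] at h
    rw [Finset.sum_range_succ, eq_div_iff (by positivity)]
    simp only [Nat.sub_self, Nat.factorial_succ m] at h ⊢
    push_cast at h ⊢
    linear_combination h
end

section
/- Work in the field K = ℚ(x,y,z) of rational functions in three variables over ℚ, and set e_1 = x+y+z, e_2 = xy+yz+zx, e_3 = xyz. For every integer r ≥ 0 the following identity holds in K: ( (x+y)^{r+1}(xy)^r + (y+z)^{r+1}(yz)^r + (z+x)^{r+1}(zx)^r ) / e_1 = (3r+2)·(−1)^r·e_3^r + Σ_{k=1}^{r} (e_3^{r−k}/k) · c_{r,k}, where c_{r,k} ∈ K is the coefficient of t^r in the polynomial (r + t/e_1)·(e_1 − t)^r·(t·e_2 − t^2·e_1 + t^3)^k ∈ K[t]. -/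
/-- The field `K = ℚ(x,y,z)` of rational functions in three variables. -/
noncomputable abbrev Kxyz : Type := FractionRing (MvPolynomial (Fin 3) ℚ)

noncomputable def xK : Kxyz := algebraMap (MvPolynomial (Fin 3) ℚ) Kxyz (MvPolynomial.X 0)
noncomputable def yK : Kxyz := algebraMap (MvPolynomial (Fin 3) ℚ) Kxyz (MvPolynomial.X 1)
noncomputable def zK : Kxyz := algebraMap (MvPolynomial (Fin 3) ℚ) Kxyz (MvPolynomial.X 2)

noncomputable def e1K : Kxyz := xK + yK + zK
noncomputable def e2K : Kxyz := xK * yK + yK * zK + zK * xK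
noncomputable def e3K : Kxyz := xK * yK * zK

/-- `c_{r,k}`: the coefficient of `t^r` in
`(r + t/e₁)·(e₁ − t)^r·(t·e₂ − t²·e₁ + t³)^k ∈ K[t]`. -/
noncomputable def cCoeff (r k : ℕ) : Kxyz :=
  ((Polynomial.C (r : Kxyz) + Polynomial.C e1K⁻¹ * Polynomial.X)
      * (Polynomial.C e1K - Polynomial.X) ^ r
      * (Polynomial.C e2K * Polynomial.X - Polynomial.C e1K * Polynomial.X ^ 2
          + Polynomial.X ^ 3) ^ k).coeff r

section ThreePoint

open Polynomial Finset

variable {K : Type*} [Field K]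

/-- A polynomial of degree at most `r + 1` evaluated at `z = u⁻¹`, through truncated geometric
series in `u`. -/
theorem eval_mul_pow_eq_coeff_mul_geom {A : K[X]} {r : ℕ} (hA : A.natDegree ≤ r + 1)
    {z u : K} (h : z * u = 1) :
    A.eval z * u ^ r
      = (A * ∑ n ∈ range (r + 1), C (u ^ n) * X ^ n).coeff r + A.coeff (r + 1) * z := by
  have hzu : ∀ n, z ^ n * u ^ n = 1 := fun n => by rw [← mul_pow, h, one_pow]
  rw [eval_eq_sum_range' (Nat.lt_succ_of_le hA), sum_range_succ, add_mul, sum_mul, coeff_mul,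
    Nat.sum_antidiagonal_eq_sum_range_succ_mk]
  congr 1
  · refine sum_congr rfl fun j hj => ?_
    have hj' : j ≤ r := Nat.lt_succ_iff.mp (mem_range.mp hj)
    have hc : (∑ n ∈ range (r + 1), C (u ^ n) * X ^ n : K[X]).coeff (r - j) = u ^ (r - j) := by
      simp only [finsetSum_coeff, coeff_C_mul_X_pow]
      rw [sum_ite_eq, if_pos (mem_range.mpr (by omega))]
    obtain ⟨m, rfl⟩ := Nat.exists_eq_add_of_le hj'
    rw [hc, Nat.add_sub_cancel_left]
    linear_combination A.coeff j * u ^ m * hzu j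
  · linear_combination A.coeff (r + 1) * z * hzu r

theorem one_sub_mul_geom (u : K) (n : ℕ) :
    (1 - C u * X) * ∑ i ∈ range n, C (u ^ i) * X ^ i = 1 - C (u ^ n) * X ^ n := by
  have h := mul_neg_geom_sum (C u * X : K[X]) n
  simp only [mul_pow, ← C_pow] at h
  exact h

/-- The truncated logarithm `∑_{k ≤ r} W^k / k` of `1 / (1 - W)`. -/
noncomputable def truncLog (W : K[X]) (r : ℕ) : K[X] :=
  ∑ k ∈ Icc 1 r, C (k : K)⁻¹ * W ^ k

theorem one_sub_mul_derivative_truncLog [CharZero K] (W : K[X]) (r : ℕ) :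
    (1 - W) * derivative (truncLog W r) = derivative W * (1 - W ^ r) := by
  have h : derivative (truncLog W r) = derivative W * ∑ k ∈ range r, W ^ k := by
    induction r with
    | zero => simp [truncLog]
    | succ n ih =>
      have hn : (C ((n + 1 : ℕ) : K)⁻¹ * C ((n + 1 : ℕ) : K) : K[X]) = 1 := by
        rw [← C_mul, inv_mul_cancel₀ (Nat.cast_ne_zero.mpr n.succ_ne_zero), C_1]
      rw [truncLog] at ih ⊢
      rw [sum_Icc_succ_top n.succ_pos, derivative_add, ih, derivative_C_mul, derivative_pow,
        sum_range_succ, Nat.add_sub_cancel]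
      linear_combination W ^ n * derivative W * hn
  rw [h, mul_left_comm, mul_neg_geom_sum]

/-- The power sums of `u, v, s` are the coefficients of the logarithmic derivative of
`(1 - u X) (1 - v X) (1 - s X)`. -/
theorem X_pow_dvd_geom_sub_derivative_truncLog [CharZero K] {W : K[X]} {u v s : K} (r : ℕ)
    (hW : 1 - W = (1 - C u * X) * (1 - C v * X) * (1 - C s * X)) :
    X ^ (r + 1) ∣
      (∑ n ∈ range (r + 1), C (u ^ n) * X ^ n) + (∑ n ∈ range (r + 1), C (v ^ n) * X ^ n)
        + (∑ n ∈ range (r + 1), C (s ^ n) * X ^ n) - 3 - X * derivative (truncLog W r) := by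
  have hW' : W = 1 - (1 - C u * X) * (1 - C v * X) * (1 - C s * X) := by
    linear_combination -hW
  have hXW : X ∣ W := by
    rw [X_dvd_iff, hW']
    simp [mul_coeff_zero]
  have hcop : IsCoprime (X ^ (r + 1)) (1 - W) := by
    obtain ⟨B, hB⟩ := hXW
    exact IsCoprime.pow_left ⟨B, 1, by rw [hB]; ring⟩
  refine hcop.dvd_of_dvd_mul_left ?_
  obtain ⟨B, hB⟩ := pow_dvd_pow_of_dvd hXW r
  have hd : derivative W = C u * ((1 - C v * X) * (1 - C s * X))
      + C v * ((1 - C u * X) * (1 - C s * X)) + C s * ((1 - C u * X) * (1 - C v * X)) := by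
    rw [hW']
    simp only [derivative_sub, derivative_mul, derivative_one, derivative_C, derivative_X]
    ring
  refine ⟨derivative W * B - C (u ^ (r + 1)) * ((1 - C v * X) * (1 - C s * X))
    - C (v ^ (r + 1)) * ((1 - C u * X) * (1 - C s * X))
    - C (s ^ (r + 1)) * ((1 - C u * X) * (1 - C v * X)), ?_⟩
  have hu := one_sub_mul_geom u (r + 1)
  have hv := one_sub_mul_geom v (r + 1)
  have hs := one_sub_mul_geom s (r + 1)
  have hQ := one_sub_mul_derivative_truncLog W r
  set Gu := ∑ n ∈ range (r + 1), C (u ^ n) * X ^ n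
  set Gv := ∑ n ∈ range (r + 1), C (v ^ n) * X ^ n
  set Gs := ∑ n ∈ range (r + 1), C (s ^ n) * X ^ n
  linear_combination (Gu + Gv + Gs - 3) * hW + (1 - C v * X) * (1 - C s * X) * hu
    + (1 - C u * X) * (1 - C s * X) * hv + (1 - C u * X) * (1 - C v * X) * hs
    - X * hQ - X * hd + X * derivative W * hB

/-- Integration by parts, with `X d/dX` acting on the coefficient of `X ^ r` as multiplication by `r`. -/
theorem coeff_sub_pow_mul_X_mul_derivative (e : K) (r : ℕ) (Q : K[X]) :
    ((C e - X) ^ (r + 1) * (X * derivative Q)).coeff r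
      = ((C (r * e) + X) * (C e - X) ^ r * Q).coeff r := by
  have h0 : ∀ B : K[X], (C (r : K) * B - X * derivative B).coeff r = 0 := by
    intro B
    cases r with
    | zero => simp
    | succ m => 
      rw [coeff_sub, coeff_C_mul, coeff_X_mul, coeff_derivative]
      push_cast
      ring
  have h := h0 ((C e - X) ^ (r + 1) * Q)
  rw [← sub_eq_zero, ← coeff_sub, ← neg_eq_zero, ← coeff_neg]
  rw [← h]
  congr 1
  rw [derivative_mul, derivative_pow_succ]
  simp only [derivative_sub, derivative_C, derivative_X, C_mul, C_add, C_1]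
  ring

theorem natDegree_C_sub_X_pow_le (e : K) (n : ℕ) : ((C e - X) ^ n).natDegree ≤ n := by
  have h : (C e - X : K[X]).natDegree ≤ 1 := by compute_degree
  simpa using natDegree_pow_le_of_le n h

theorem coeff_C_sub_X_pow_self (e : K) (n : ℕ) : ((C e - X) ^ n).coeff n = (-1) ^ n := by
  have h : (C e - X : K[X]) = C (-1) * (X + C (-e)) := by simp; ring
  rw [h, mul_pow, ← C_pow, coeff_C_mul, coeff_X_add_C_pow]
  simp

theorem coeff_C_sub_X_pow_succ (e : K) (n : ℕ) :
    ((C e - X) ^ (n + 1)).coeff n = (-1) ^ n * ((n + 1) * e) := by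
  have h : (C e - X : K[X]) = C (-1) * (X + C (-e)) := by simp; ring
  rw [h, mul_pow, ← C_pow, coeff_C_mul, coeff_X_add_C_pow]
  simp
  ring

theorem three_point_identity_of_field [CharZero K] {x y z : K} (hx : x ≠ 0) (hy : y ≠ 0)
    (hz : z ≠ 0) (he : x + y + z ≠ 0) (r : ℕ) :
    ((x + y) ^ (r + 1) * (x * y) ^ r + (y + z) ^ (r + 1) * (y * z) ^ r
      + (z + x) ^ (r + 1) * (z * x) ^ r) / (x + y + z)
    = ((3 * r + 2 : ℕ) : K) * (-1) ^ r * (x * y * z) ^ r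
      + ∑ k ∈ Icc 1 r, ((x * y * z) ^ (r - k) / (k : K)) *
        ((C (r : K) + C (x + y + z)⁻¹ * X) * (C (x + y + z) - X) ^ r
          * (C (x * y + y * z + z * x) * X - C (x + y + z) * X ^ 2 + X ^ 3) ^ k).coeff r := by
  obtain ⟨e, he_def⟩ : ∃ e, e = x + y + z := ⟨_, rfl⟩
  rw [← he_def] at he ⊢
  set g : K[X] := C (x * y + y * z + z * x) * X - C e * X ^ 2 + X ^ 3 with hg
  have he3 : x * y * z ≠ 0 := mul_ne_zero (mul_ne_zero hx hy) hz
  set W : K[X] := C (x * y * z)⁻¹ * g with hWdef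
  have hlin : ∀ {a : K}, a ≠ 0 → (1 - C a⁻¹ * X : K[X]) = C a⁻¹ * (C a - X) := by
    intro a ha
    rw [mul_sub, ← C_mul, inv_mul_cancel₀ ha, C_1]
  have hW : 1 - W = (1 - C x⁻¹ * X) * (1 - C y⁻¹ * X) * (1 - C z⁻¹ * X) := by
    have h1 : (C (x * y * z)⁻¹ * C (x * y * z) : K[X]) = 1 := by
      rw [← C_mul, inv_mul_cancel₀ he3, C_1]
    have h2 : (C (x * y * z)⁻¹ : K[X]) = C x⁻¹ * C y⁻¹ * C z⁻¹ := by
      rw [← C_mul, ← C_mul, mul_inv, mul_inv]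
    rw [hlin hx, hlin hy, hlin hz, hWdef, ← h1]
    rw [h2, hg, he_def]
    simp only [C_mul, C_add]
    ring
  obtain ⟨B, hB⟩ := X_pow_dvd_geom_sub_derivative_truncLog r hW
  set A : K[X] := (C e - X) ^ (r + 1) with hA
  have hdeg : A.natDegree ≤ r + 1 := natDegree_C_sub_X_pow_le e (r + 1)
  have hcoeff := congrArg (fun p => (A * p).coeff r) hB
  have hvanish : (A * (X ^ (r + 1) * B)).coeff r = 0 := by
    rw [mul_left_comm]
    exact (X_pow_dvd_iff.mp (Dvd.intro _ rfl)) r (Nat.lt_succ_self r)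
  have h3 : (A * 3).coeff r = 3 * A.coeff r := by
    rw [mul_comm, show (3 : K[X]) = C 3 from rfl, coeff_C_mul]
  simp only [hvanish, mul_sub, mul_add, coeff_sub, coeff_add, h3] at hcoeff
  have hx' := eval_mul_pow_eq_coeff_mul_geom hdeg (mul_inv_cancel₀ hx)
  have hy' := eval_mul_pow_eq_coeff_mul_geom hdeg (mul_inv_cancel₀ hy)
  have hz' := eval_mul_pow_eq_coeff_mul_geom hdeg (mul_inv_cancel₀ hz)
  have hsum : (A * (X * derivative (truncLog W r))).coeff r * (x * y * z) ^ r
      = e * ∑ k ∈ Icc 1 r, ((x * y * z) ^ (r - k) / (k : K)) *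
        ((C (r : K) + C e⁻¹ * X) * (C e - X) ^ r * g ^ k).coeff r := by
    rw [hA, coeff_sub_pow_mul_X_mul_derivative, truncLog, mul_sum, finsetSum_coeff, sum_mul,
      mul_sum]
    refine sum_congr rfl fun k hk => ?_
    have hCe : (C (r * e) + X : K[X]) = C e * (C (r : K) + C e⁻¹ * X) := by
      rw [mul_add, ← mul_assoc, ← C_mul, ← C_mul, mul_inv_cancel₀ he, C_1, one_mul, mul_comm]
    have hk' : (x * y * z) ^ r = (x * y * z) ^ (r - k) * (x * y * z) ^ k := by
      rw [← pow_add, Nat.sub_add_cancel (mem_Icc.mp hk).2]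
    have hpoly : (C (r * e) + X) * (C e - X) ^ r * (C (k : K)⁻¹ * W ^ k)
        = C (e * (k : K)⁻¹ * ((x * y * z)⁻¹) ^ k)
          * ((C (r : K) + C e⁻¹ * X) * (C e - X) ^ r * g ^ k) := by
      rw [hCe, hWdef, mul_pow]
      simp only [C_mul, C_pow]
      ring
    rw [hpoly, coeff_C_mul, hk', inv_pow]
    field_simp
  have hAr : A.coeff r = (-1) ^ r * ((r + 1) * e) := coeff_C_sub_X_pow_succ e r
  have hAr' : A.coeff (r + 1) = (-1) ^ (r + 1) := coeff_C_sub_X_pow_self e (r + 1)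
  have heval : ∀ a, A.eval a = (e - a) ^ (r + 1) := fun a => by simp [hA]
  rw [heval] at hx' hy' hz'
  have ex : (y + z) ^ (r + 1) * (y * z) ^ r
      = (e - x) ^ (r + 1) * x⁻¹ ^ r * (x * y * z) ^ r := by
    rw [mul_assoc, ← mul_pow x⁻¹]
    congr 2
    · rw [he_def]; ring
    · field_simp
  have ey : (z + x) ^ (r + 1) * (z * x) ^ r
      = (e - y) ^ (r + 1) * y⁻¹ ^ r * (x * y * z) ^ r := by
    rw [mul_assoc, ← mul_pow y⁻¹]
    congr 2
    · rw [he_def]; ring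
    · field_simp
  have ez : (x + y) ^ (r + 1) * (x * y) ^ r
      = (e - z) ^ (r + 1) * z⁻¹ ^ r * (x * y * z) ^ r := by
    rw [mul_assoc, ← mul_pow z⁻¹]
    congr 2
    · rw [he_def]; ring
    · field_simp
  rw [div_eq_iff he, ex, ey, ez, hx', hy', hz', hAr', add_mul _ _ e,
    mul_comm (∑ k ∈ Icc 1 r, _) e, ← hsum]
  rw [hAr] at hcoeff
  push_cast
  linear_combination (x * y * z) ^ r * hcoeff + (-1) ^ r * (x * y * z) ^ r * he_def

end ThreePoint

/-- The three-point identity (Section 4.3): for every `r ≥ 0`, in `ℚ(x,y,z)`,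
`((x+y)^{r+1}(xy)^r + (y+z)^{r+1}(yz)^r + (z+x)^{r+1}(zx)^r)/e₁
  = (3r+2)·(−1)^r·e₃^r + Σ_{k=1}^{r} (e₃^{r−k}/k)·c_{r,k}`. -/
theorem three_point_identity (r : ℕ) :
    ((xK + yK) ^ (r + 1) * (xK * yK) ^ r
      + (yK + zK) ^ (r + 1) * (yK * zK) ^ r
      + (zK + xK) ^ (r + 1) * (zK * xK) ^ r) / e1K
    = ((3 * r + 2 : ℕ) : Kxyz) * (-1) ^ r * e3K ^ r
      + ∑ k ∈ Finset.Icc 1 r, (e3K ^ (r - k) / (k : Kxyz)) * cCoeff r k := by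
  have inj := IsFractionRing.injective (MvPolynomial (Fin 3) ℚ) Kxyz
  have hX : ∀ i : Fin 3, algebraMap (MvPolynomial (Fin 3) ℚ) Kxyz (MvPolynomial.X i) ≠ 0 :=
    fun i => (map_ne_zero_iff _ inj).mpr (MvPolynomial.X_ne_zero i)
  have he : xK + yK + zK ≠ 0 := by
    rw [xK, yK, zK, ← map_add, ← map_add, map_ne_zero_iff _ inj]
    intro h
    have := congrArg (MvPolynomial.eval fun _ => (1 : ℚ)) h
    norm_num at this
  exact three_point_identity_of_field (hX 0) (hX 1) (hX 2) he r
end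

section
/- In the polynomial ring ℚ[x,y,z], set e_1 = x+y+z, e_2 = xy+yz+zx, e_3 = xyz. For every integer m ≥ 1: (xy)^m + (yz)^m + (zx)^m = Σ_{k=1}^{m} (m/k) · e_3^{m−k} · c_{m,k}, where c_{m,k} ∈ ℚ[x,y,z] is the coefficient of t^m in the polynomial (t·e_2 − t^2·e_1 + t^3)^k ∈ ℚ[x,y,z][t]. -/
open MvPolynomial

noncomputable def xP : MvPolynomial (Fin 3) ℚ := X 0
noncomputable def yP : MvPolynomial (Fin 3) ℚ := X 1
noncomputable def zP : MvPolynomial (Fin 3) ℚ := X 2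

noncomputable def e1P : MvPolynomial (Fin 3) ℚ := xP + yP + zP
noncomputable def e2P : MvPolynomial (Fin 3) ℚ := xP * yP + yP * zP + zP * xP
noncomputable def e3P : MvPolynomial (Fin 3) ℚ := xP * yP * zP

/-- `c_{m,k}`: the coefficient of `t^m` in `(t·e₂ − t²·e₁ + t³)^k ∈ ℚ[x,y,z][t]`. -/
noncomputable def cCoeffP (m k : ℕ) : MvPolynomial (Fin 3) ℚ :=
  ((Polynomial.C e2P * Polynomial.X - Polynomial.C e1P * Polynomial.X ^ 2
      + Polynomial.X ^ 3) ^ k).coeff m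

open Polynomial in
/-- Power sums as coefficients of the logarithmic derivative: if `∏ (1 - aᵢ t) = 1 - t v(t)`, then
`∑ aᵢ ^ (n + 1)` is the coefficient of `t ^ n` in the product of the derivative of `t v` with the truncated
geometric series of `t v`. -/
theorem Polynomial.sum_pow_succ_eq_coeff_derivative_mul_geom_sum {R ι : Type*} [CommRing R]
    [DecidableEq ι] (s : Finset ι) (a : ι → R) (v : R[X])
    (h : ∏ i ∈ s, (1 - C (a i) * X) = 1 - X * v) (n : ℕ) :
    ∑ i ∈ s, a i ^ (n + 1) =
      (derivative (X * v) * ∑ j ∈ Finset.range (n + 1), (X * v) ^ j).coeff n := by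
  set S := ∑ j ∈ Finset.range (n + 1), (X * v) ^ j
  have hgeom : (1 - X * v) * S = 1 - (X * v) ^ (n + 1) := mul_neg_geom_sum _ _
  have hderiv : derivative (X * v) =
      ∑ i ∈ s, (∏ j ∈ s.erase i, (1 - C (a j) * X)) * C (a i) := by
    have h' := congrArg derivative h
    rw [derivative_prod_finset] at h'
    simp only [derivative_sub, derivative_one, derivative_C_mul, derivative_X, zero_sub, mul_one,
      mul_neg, Finset.sum_neg_distrib, neg_inj] at h'
    exact h'.symm
  have hterm : ∀ i ∈ s, (((∏ j ∈ s.erase i, (1 - C (a j) * X)) * C (a i)) * S).coeff n =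
      a i ^ (n + 1) := by
    intro i hi
    set P := ∏ j ∈ s.erase i, (1 - C (a j) * X)
    set g := ∑ j ∈ Finset.range (n + 1), (C (a i) * X) ^ j with hg
    have hP : (1 - C (a i) * X) * P = 1 - X * v := by
      rw [← h, Finset.mul_prod_erase s (fun j => 1 - C (a j) * X) hi]
    have hga : (1 - C (a i) * X) * g = 1 - (C (a i) * X) ^ (n + 1) := mul_neg_geom_sum _ _
    have key : P * C (a i) * S = C (a i) * g +
        X ^ (n + 1) * (C (a i) ^ (n + 1) * P * C (a i) * S - C (a i) * g * v ^ (n + 1)) := by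
      rw [mul_pow] at hgeom hga
      linear_combination (-P * C (a i) * S) * hga + C (a i) * g * S * hP + C (a i) * g * hgeom
    rw [key, coeff_add, coeff_X_pow_mul', if_neg (by lia), add_zero, coeff_C_mul, hg,
      finsetSum_coeff]
    simp only [mul_pow, ← C_pow, coeff_C_mul_X_pow]
    simp [pow_succ']
  rw [hderiv, Finset.sum_mul, finsetSum_coeff]
  exact (Finset.sum_congr rfl hterm).symm

open Polynomial in
theorem Polynomial.natCast_div_smul_coeff_pow {R : Type*} [CommRing R] [Algebra ℚ R]
    (p : R[X]) (n k : ℕ) :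
    (((n + 1 : ℕ) : ℚ) / ((k + 1 : ℕ) : ℚ)) • (p ^ (k + 1)).coeff (n + 1) =
      (derivative p * p ^ k).coeff n := by
  have h := coeff_derivative (p ^ (k + 1)) n
  rw [derivative_pow_succ, ← Nat.cast_one, ← Nat.cast_add, C_eq_natCast, mul_assoc,
    coeff_natCast_mul, mul_comm (p ^ k)] at h
  have hk : ((k + 1 : ℕ) : ℚ) ≠ 0 := by positivity
  rw [div_eq_inv_mul, mul_smul, inv_smul_eq_iff₀ hk, Nat.cast_smul_eq_nsmul,
    Nat.cast_smul_eq_nsmul, nsmul_eq_mul, nsmul_eq_mul, h]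
  push_cast
  ring

open Polynomial in
/-- Expansion of the logarithm of `∏ (1 - aᵢ t) = 1 - t v(t)` in two ways. -/
theorem Polynomial.sum_pow_eq_sum_smul_coeff_pow {R ι : Type*} [CommRing R] [Algebra ℚ R]
    [DecidableEq ι] (s : Finset ι) (a : ι → R) (v : R[X])
    (h : ∏ i ∈ s, (1 - C (a i) * X) = 1 - X * v) {m : ℕ} (hm : 1 ≤ m) :
    ∑ i ∈ s, a i ^ m =
      ∑ k ∈ Finset.Icc 1 m, ((m : ℚ) / (k : ℚ)) • ((X * v) ^ k).coeff m := by
  obtain ⟨n, rfl⟩ := Nat.exists_eq_add_of_le' hm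
  rw [sum_pow_succ_eq_coeff_derivative_mul_geom_sum s a v h, Finset.mul_sum, finsetSum_coeff,
    ← Finset.Ico_add_one_right_eq_Icc, Finset.sum_Ico_eq_sum_range]
  refine Finset.sum_congr (by simp) fun k _ => ?_
  rw [add_comm 1 k, natCast_div_smul_coeff_pow]

open Polynomial in
theorem Polynomial.coeff_X_mul_comp_C_mul_X_pow {R : Type*} [CommRing R] (w : R[X]) (r : R)
    {m k : ℕ} (hk : k ≤ m) :
    ((X * w.comp (C r * X)) ^ k).coeff m = r ^ (m - k) * ((X * w) ^ k).coeff m := by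
  rw [mul_pow, mul_pow, coeff_X_pow_mul', coeff_X_pow_mul', if_pos hk, if_pos hk, ← pow_comp,
    comp_C_mul_X_coeff, mul_comm]

/-- The Newton-type identity from the `n = 3` section: for `m ≥ 1`, in `ℚ[x,y,z]`,
`(xy)^m + (yz)^m + (zx)^m = Σ_{k=1}^{m} (m/k) · e₃^{m−k} · c_{m,k}`. -/
theorem newton_type_identity (m : ℕ) (hm : 1 ≤ m) :
    (xP * yP) ^ m + (yP * zP) ^ m + (zP * xP) ^ m
    = ∑ k ∈ Finset.Icc 1 m, ((m : ℚ) / (k : ℚ)) • (e3P ^ (m - k) * cCoeffP m k) := by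
  have h := Polynomial.sum_pow_eq_sum_smul_coeff_pow Finset.univ
    ![xP * yP, yP * zP, zP * xP]
    ((Polynomial.C e2P - Polynomial.C e1P * Polynomial.X + Polynomial.X ^ 2).comp
      (Polynomial.C e3P * Polynomial.X)) (by
        simp [Fin.prod_univ_three, e1P, e2P, e3P]
        ring) hm
  rw [Fin.sum_univ_three] at h
  refine h.trans (Finset.sum_congr rfl fun k hk => ?_)
  rw [Polynomial.coeff_X_mul_comp_C_mul_X_pow _ _ (Finset.mem_Icc.mp hk).2, cCoeffP]
  congr 4
  ring
end
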